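/- Let Q ⊂ ℙ⁴ be a smooth quadric threefold and q ⊂ Q a smooth conic. The subvariety S_q ⊂ Hilb^Q_1 ≅ ℙ³ parameterizing lines of Q that meet q is a smooth quadric surface in ℙ³. -/

import Mathlib

open Module

/-- The quadratic form `b² + ac + df` on `ℂ⁵`, in the coordinates `(a, b, c, d, f)`. -/
def splitForm (v : Fin 5 → ℂ) : ℂ := v 1 ^ 2 + v 0 * v 2 + v 3 * v 4

/-- The Clifford action of `ℂ⁵`, with the form `splitForm`, on the space `ℂ⁴` of spinors. -/
def spinorAction : (Fin 4 → ℂ) →ₗ[ℂ] (Fin 5 → ℂ) →ₗ[ℂ] (Fin 4 → ℂ) :=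
  LinearMap.mk₂ ℂ (fun s v ↦
    ![v 1 * s 0 + v 0 * s 1 + v 3 * s 2, v 2 * s 0 - v 1 * s 1 + v 3 * s 3,
      v 4 * s 0 - v 1 * s 2 - v 0 * s 3, v 4 * s 1 - v 2 * s 2 + v 1 * s 3])
    (by intros; ext i; fin_cases i <;> simp <;> ring)
    (by intros; ext i; fin_cases i <;> simp <;> ring)
    (by intros; ext i; fin_cases i <;> simp <;> ring)
    (by intros; ext i; fin_cases i <;> simp <;> ring)

/-- The invariant symplectic form on the space of spinors. -/
def spinorSymplectic : LinearMap.BilinForm ℂ (Fin 4 → ℂ) :=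
  LinearMap.mk₂ ℂ (fun s t ↦ s 0 * t 3 - s 1 * t 2 + s 2 * t 1 - s 3 * t 0)
    (by intros; simp; ring) (by intros; simp; ring)
    (by intros; simp; ring) (by intros; simp; ring)

/-- The polarization of the quadric `s₀ s₃ - s₁ s₂` in the space of spinors. -/
def spinorQuadric : LinearMap.BilinForm ℂ (Fin 4 → ℂ) :=
  LinearMap.mk₂ ℂ (fun s t ↦ s 0 * t 3 - s 1 * t 2 - s 2 * t 1 + s 3 * t 0)
    (by intros; simp; ring) (by intros; simp; ring)
    (by intros; simp; ring) (by intros; simp; ring)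

theorem spinorSymplectic_apply (s t : Fin 4 → ℂ) :
    spinorSymplectic s t = s 0 * t 3 - s 1 * t 2 + s 2 * t 1 - s 3 * t 0 := rfl

theorem spinorQuadric_apply (s t : Fin 4 → ℂ) :
    spinorQuadric s t = s 0 * t 3 - s 1 * t 2 - s 2 * t 1 + s 3 * t 0 := rfl

theorem spinorAction_eq_zero_iff (s : Fin 4 → ℂ) (v : Fin 5 → ℂ) :
    spinorAction s v = 0 ↔
      v 1 * s 0 + v 0 * s 1 + v 3 * s 2 = 0 ∧ v 2 * s 0 - v 1 * s 1 + v 3 * s 3 = 0 ∧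
      v 4 * s 0 - v 1 * s 2 - v 0 * s 3 = 0 ∧ v 4 * s 1 - v 2 * s 2 + v 1 * s 3 = 0 := by
  simp [spinorAction, funext_iff, Fin.forall_fin_succ]

theorem spinorAction_spinorAction (s : Fin 4 → ℂ) (v : Fin 5 → ℂ) :
    spinorAction (spinorAction s v) v = splitForm v • s := by
  ext i; fin_cases i <;> simp [spinorAction, splitForm] <;> ring

theorem spinorSymplectic_spinorAction (s : Fin 4 → ℂ) (v : Fin 5 → ℂ) :
    spinorSymplectic s (spinorAction s v) = 0 := by
  simp [spinorAction, spinorSymplectic_apply]; ring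

theorem spinorSymplectic_isAlt : spinorSymplectic.IsAlt := by
  intro s; rw [spinorSymplectic_apply]; ring

theorem spinorSymplectic_nondegenerate : spinorSymplectic.Nondegenerate := by
  have h : spinorSymplectic.SeparatingLeft := fun s hs ↦ by
    have h0 := hs (Pi.single 0 1)
    have h1 := hs (Pi.single 1 1)
    have h2 := hs (Pi.single 2 1)
    have h3 := hs (Pi.single 3 1)
    simp [spinorSymplectic_apply] at h0 h1 h2 h3
    ext i; fin_cases i <;> simpa
  exact ⟨h, fun t ht ↦ h t fun s ↦ spinorSymplectic_isAlt.isRefl _ _ (ht s)⟩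

theorem spinorQuadric_isSymm : spinorQuadric.IsSymm :=
  ⟨fun s t ↦ by simp only [spinorQuadric_apply]; ring⟩

theorem spinorQuadric_nondegenerate : spinorQuadric.Nondegenerate := by
  have h : spinorQuadric.SeparatingLeft := fun s hs ↦ by
    have h0 := hs (Pi.single 0 1)
    have h1 := hs (Pi.single 1 1)
    have h2 := hs (Pi.single 2 1)
    have h3 := hs (Pi.single 3 1)
    simp [spinorQuadric_apply] at h0 h1 h2 h3
    ext i; fin_cases i <;> simpa
  exact ⟨h, fun t ht ↦ h t fun s ↦ spinorQuadric_isSymm.isRefl _ _ (ht s)⟩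

/-- The vector of `ℂ⁵` attached to a pair of spinors: it spans the common annihilator of two
independent symplectically orthogonal spinors. -/
def spinorPairing (s t : Fin 4 → ℂ) : Fin 5 → ℂ :=
  ![s 2 * t 0 - s 0 * t 2, s 0 * t 3 - s 3 * t 0, s 1 * t 3 - s 3 * t 1,
    s 0 * t 1 - s 1 * t 0, s 2 * t 3 - s 3 * t 2]

theorem spinorAction_spinorPairing_left {s t : Fin 4 → ℂ} (h : spinorSymplectic s t = 0) :
    spinorAction s (spinorPairing s t) = 0 := by
  rw [spinorSymplectic_apply] at h
  simp only [spinorAction_eq_zero_iff, spinorPairing, Matrix.cons_val]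
  refine ⟨?_, ?_, ?_, ?_⟩ <;> grind

theorem spinorAction_spinorPairing_right {s t : Fin 4 → ℂ} (h : spinorSymplectic s t = 0) :
    spinorAction t (spinorPairing s t) = 0 := by
  rw [spinorSymplectic_apply] at h
  simp only [spinorAction_eq_zero_iff, spinorPairing, Matrix.cons_val]
  refine ⟨?_, ?_, ?_, ?_⟩ <;> grind

theorem exists_smul_eq_of_spinorPairing_eq_zero {s t : Fin 4 → ℂ} (hs : s ≠ 0)
    (h : spinorSymplectic s t = 0) (hp : spinorPairing s t = 0) : ∃ c : ℂ, t = c • s := by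
  obtain ⟨i, hi⟩ := Function.ne_iff.1 hs
  refine ⟨t i / s i, ?_⟩
  rw [spinorSymplectic_apply] at h
  simp [spinorPairing, funext_iff, Fin.forall_fin_succ] at hp
  ext j
  simp only [Pi.smul_apply, smul_eq_mul, Pi.zero_apply] at hi ⊢
  rw [div_mul_eq_mul_div, eq_div_iff hi]
  fin_cases i <;> fin_cases j <;> simp <;> grind

/-- A vector annihilating two spinors is proportional to their pairing. -/
theorem spinorPairing_mul_comm {s t : Fin 4 → ℂ} {v : Fin 5 → ℂ} (hs : spinorAction s v = 0)
    (ht : spinorAction t v = 0) (i j : Fin 5) :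
    spinorPairing s t i * v j = spinorPairing s t j * v i := by
  rw [spinorAction_eq_zero_iff] at hs ht
  fin_cases i <;> fin_cases j <;> simp [spinorPairing] <;> grind

theorem spinorSymplectic_eq_zero {s t : Fin 4 → ℂ} {v : Fin 5 → ℂ} (hv : v ≠ 0)
    (hs : spinorAction s v = 0) (ht : spinorAction t v = 0) : spinorSymplectic s t = 0 := by
  obtain ⟨i, hi⟩ := Function.ne_iff.1 hv
  rw [spinorAction_eq_zero_iff] at hs ht
  rw [spinorSymplectic_apply]
  refine (mul_eq_zero.1 ?_).resolve_left hi
  fin_cases i <;> simp <;> grind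

theorem exists_spinorAction_eq_zero_iff {s : Fin 4 → ℂ} (hs : s ≠ 0) :
    (∃ v : Fin 5 → ℂ, v ≠ 0 ∧ v 3 = 0 ∧ v 4 = 0 ∧ spinorAction s v = 0) ↔
      spinorQuadric s s = 0 := by
  simp only [spinorQuadric_apply, spinorAction_eq_zero_iff]
  constructor
  · rintro ⟨v, hv, h3, h4, h⟩
    obtain ⟨i, hi⟩ := Function.ne_iff.1 hv
    refine (mul_eq_zero.1 ?_).resolve_left hi
    fin_cases i <;> simp <;> grind
  · intro h
    by_cases h01 : s 0 = 0 ∧ s 1 = 0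
    · refine ⟨![-s 2 ^ 2, s 2 * s 3, s 3 ^ 2, 0, 0], fun h0 ↦ hs ?_, ?_⟩
      · simp [funext_iff, Fin.forall_fin_succ] at h0 ⊢
        grind
      · simp only [Matrix.cons_val]
        grind
    · refine ⟨![-s 0 ^ 2, s 0 * s 1, s 1 ^ 2, 0, 0], fun h0 ↦ h01 ?_, ?_⟩
      · simp [funext_iff, Fin.forall_fin_succ] at h0 ⊢
        grind
      · simp only [Matrix.cons_val]
        grind

section

variable {V : Type*} [AddCommGroup V] [Module ℂ V]

/-- The linear subspace annihilating a spinor. -/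
def spinorKernel (Φ : V ≃ₗ[ℂ] (Fin 5 → ℂ)) (s : Fin 4 → ℂ) : Submodule ℂ V :=
  LinearMap.ker (spinorAction s ∘ₗ Φ.toLinearMap)

theorem mem_spinorKernel {Φ : V ≃ₗ[ℂ] (Fin 5 → ℂ)} {s : Fin 4 → ℂ} {v : V} :
    v ∈ spinorKernel Φ s ↔ spinorAction s (Φ v) = 0 := by
  simp [spinorKernel]

theorem spinorKernel_smul (Φ : V ≃ₗ[ℂ] (Fin 5 → ℂ)) {c : ℂ} (hc : c ≠ 0) (s : Fin 4 → ℂ) :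
    spinorKernel Φ (c • s) = spinorKernel Φ s := by
  ext v; simp [mem_spinorKernel, hc]

theorem isotropic_of_mem_spinorKernel {B : LinearMap.BilinForm ℂ V} {Φ : V ≃ₗ[ℂ] (Fin 5 → ℂ)}
    (hΦ : ∀ v, B v v = splitForm (Φ v)) {s : Fin 4 → ℂ} (hs : s ≠ 0) {v : V}
    (hv : v ∈ spinorKernel Φ s) : B v v = 0 := by
  have h := spinorAction_spinorAction s (Φ v)
  rw [mem_spinorKernel.1 hv, map_zero, LinearMap.zero_apply, eq_comm, smul_eq_zero] at h
  rw [hΦ]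
  exact h.resolve_right hs

theorem bilin_eq_zero_of_isotropic {B : LinearMap.BilinForm ℂ V} (hB : B.IsSymm)
    {L : Submodule ℂ V} (hL : ∀ v ∈ L, B v v = 0) {v w : V} (hv : v ∈ L) (hw : w ∈ L) :
    B v w = 0 := by
  rw [hB.polarization, hL _ (L.add_mem hv hw), hL v hv, hL w hw]; simp

variable [FiniteDimensional ℂ V]

theorem two_mul_finrank_le_of_isotropic {B : LinearMap.BilinForm ℂ V} (hB : B.IsSymm)
    (hnd : B.Nondegenerate) {L : Submodule ℂ V} (hL : ∀ v ∈ L, B v v = 0) :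
    2 * finrank ℂ L ≤ finrank ℂ V := by
  have hle : L ≤ B.orthogonal L := fun v hv w hw ↦ bilin_eq_zero_of_isotropic hB hL hw hv
  have h1 := Submodule.finrank_mono hle
  have h2 := L.finrank_le
  rw [LinearMap.BilinForm.finrank_orthogonal hnd] at h1
  omega

theorem finrank_ker_spinorSymplectic {s : Fin 4 → ℂ} (hs : s ≠ 0) :
    finrank ℂ (LinearMap.ker (spinorSymplectic s)) = 3 := by
  have hne : spinorSymplectic s ≠ 0 := fun h ↦
    hs (spinorSymplectic_nondegenerate.1 s fun t ↦ by rw [h, LinearMap.zero_apply])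
  have h := Dual.finrank_ker_add_one_of_ne_zero hne
  rw [finrank_fin_fun] at h
  omega

theorem exists_ker_spinorSymplectic_eq {H : Submodule ℂ (Fin 4 → ℂ)} (hH : finrank ℂ H = 3) :
    ∃ s : Fin 4 → ℂ, s ≠ 0 ∧ H = LinearMap.ker (spinorSymplectic s) := by
  have h1 : finrank ℂ (spinorSymplectic.orthogonal H) = 1 := by
    rw [LinearMap.BilinForm.finrank_orthogonal spinorSymplectic_nondegenerate, hH,
      finrank_fin_fun]
  obtain ⟨s, hs, hs0⟩ := (spinorSymplectic.orthogonal H).exists_mem_ne_zero_of_ne_bot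
    fun h ↦ by rw [h, finrank_bot] at h1; omega
  refine ⟨s, hs0, Submodule.eq_of_le_of_finrank_eq (fun t ht ↦ ?_) ?_⟩
  · exact spinorSymplectic_isAlt.isRefl _ _ (hs t ht)
  · rw [hH, finrank_ker_spinorSymplectic hs0]

theorem finrank_spinorKernel {B : LinearMap.BilinForm ℂ V} (hB : B.IsSymm)
    (hnd : B.Nondegenerate) {Φ : V ≃ₗ[ℂ] (Fin 5 → ℂ)} (hΦ : ∀ v, B v v = splitForm (Φ v))
    {s : Fin 4 → ℂ} (hs : s ≠ 0) : finrank ℂ (spinorKernel Φ s) = 2 := by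
  have hV : finrank ℂ V = 5 := by rw [Φ.finrank_eq, finrank_fin_fun]
  have hle := two_mul_finrank_le_of_isotropic hB hnd
    fun v hv ↦ isotropic_of_mem_spinorKernel hΦ hs (v := v) hv
  have hrange : LinearMap.range (spinorAction s ∘ₗ Φ.toLinearMap) ≤
      LinearMap.ker (spinorSymplectic s) := by
    rintro _ ⟨v, rfl⟩
    exact spinorSymplectic_spinorAction s (Φ v)
  have h3 := Submodule.finrank_mono hrange
  have h := (spinorAction s ∘ₗ Φ.toLinearMap).finrank_range_add_finrank_ker
  rw [finrank_ker_spinorSymplectic hs] at h3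
  unfold spinorKernel at hle ⊢
  omega

/-- Two lines of the quadric threefold meet exactly when the corresponding spinors are
symplectically orthogonal. -/
theorem spinorKernel_inf_ne_bot_iff {B : LinearMap.BilinForm ℂ V} (hB : B.IsSymm)
    (hnd : B.Nondegenerate) {Φ : V ≃ₗ[ℂ] (Fin 5 → ℂ)} (hΦ : ∀ v, B v v = splitForm (Φ v))
    {s t : Fin 4 → ℂ} (hs : s ≠ 0) (ht : t ≠ 0) :
    spinorKernel Φ s ⊓ spinorKernel Φ t ≠ ⊥ ↔ spinorSymplectic s t = 0 := by
  constructor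
  · intro h
    obtain ⟨v, ⟨hvs, hvt⟩, hv⟩ := Submodule.exists_mem_ne_zero_of_ne_bot h
    exact spinorSymplectic_eq_zero (Φ.map_ne_zero_iff.2 hv) (mem_spinorKernel.1 hvs)
      (mem_spinorKernel.1 hvt)
  · intro h
    by_cases hp : spinorPairing s t = 0
    · obtain ⟨c, rfl⟩ := exists_smul_eq_of_spinorPairing_eq_zero hs h hp
      rw [spinorKernel_smul Φ (fun hc ↦ ht (by rw [hc, zero_smul])), inf_idem]
      intro hbot
      have := finrank_spinorKernel hB hnd hΦ hs
      rw [hbot, finrank_bot] at this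
      omega
    · refine (Submodule.ne_bot_iff _).2 ⟨Φ.symm (spinorPairing s t), ⟨?_, ?_⟩, ?_⟩
      · simpa [mem_spinorKernel] using spinorAction_spinorPairing_left h
      · simpa [mem_spinorKernel] using spinorAction_spinorPairing_right h
      · simpa using hp

theorem exists_smul_eq_of_spinorKernel_eq {B : LinearMap.BilinForm ℂ V} (hB : B.IsSymm)
    (hnd : B.Nondegenerate) {Φ : V ≃ₗ[ℂ] (Fin 5 → ℂ)} (hΦ : ∀ v, B v v = splitForm (Φ v))
    {s t : Fin 4 → ℂ} (hs : s ≠ 0) (h : spinorKernel Φ s = spinorKernel Φ t) :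
    ∃ c : ℂ, t = c • s := by
  have h2 := finrank_spinorKernel hB hnd hΦ hs
  have hne : spinorKernel Φ s ≠ ⊥ := fun hbot ↦ by rw [hbot, finrank_bot] at h2; omega
  obtain ⟨v, hvs, hv⟩ := Submodule.exists_mem_ne_zero_of_ne_bot hne
  refine exists_smul_eq_of_spinorPairing_eq_zero hs (spinorSymplectic_eq_zero
    (Φ.map_ne_zero_iff.2 hv) (mem_spinorKernel.1 hvs) (mem_spinorKernel.1 (h ▸ hvs))) ?_
  by_contra hp
  obtain ⟨i, hi⟩ := Function.ne_iff.1 hp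
  have hle : spinorKernel Φ s ≤ ℂ ∙ Φ.symm (spinorPairing s t) := fun w hw ↦ by
    refine Submodule.mem_span_singleton.2 ⟨Φ w i / spinorPairing s t i, Φ.injective ?_⟩
    ext j
    have := spinorPairing_mul_comm (mem_spinorKernel.1 hw) (mem_spinorKernel.1 (h ▸ hw)) i j
    simp only [map_smul, LinearEquiv.apply_symm_apply, Pi.smul_apply, smul_eq_mul]
    rw [div_mul_eq_mul_div, div_eq_iff hi]
    linear_combination -this
  have h1 := (Submodule.finrank_mono hle).trans (finrank_span_le_card _)
  simp [h2] at h1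

theorem exists_eq_spinorKernel {B : LinearMap.BilinForm ℂ V} (hB : B.IsSymm)
    (hnd : B.Nondegenerate) {Φ : V ≃ₗ[ℂ] (Fin 5 → ℂ)} (hΦ : ∀ v, B v v = splitForm (Φ v))
    {L : Submodule ℂ V} (hL2 : finrank ℂ L = 2) (hL : ∀ v ∈ L, B v v = 0) :
    ∃ s : Fin 4 → ℂ, s ≠ 0 ∧ spinorKernel Φ s = L := by
  obtain ⟨b⟩ : Nonempty (Basis (Fin 2) ℂ L) := ⟨finBasisOfFinrankEq ℂ L hL2⟩
  have hsq (v : L) (s : Fin 4 → ℂ) : spinorAction (spinorAction s (Φ v)) (Φ v) = 0 := by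
    rw [spinorAction_spinorAction, ← hΦ, hL _ v.2, zero_smul]
  have hanti (v w : L) (s : Fin 4 → ℂ) (hs : spinorAction s (Φ v) = 0) :
      spinorAction (spinorAction s (Φ w)) (Φ v) = 0 := by
    have h := hsq (v + w) s
    simpa [hs, hsq w s] using h
  obtain ⟨s, hs0, hs⟩ : ∃ s : Fin 4 → ℂ, s ≠ 0 ∧ spinorAction s (Φ (b 0)) = 0 := by
    obtain ⟨x, hx⟩ := exists_ne (0 : Fin 4 → ℂ)
    by_cases h : spinorAction x (Φ (b 0)) = 0
    · exact ⟨x, hx, h⟩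
    · exact ⟨_, h, hsq _ _⟩
  obtain ⟨t, ht0, ht, ht'⟩ : ∃ t : Fin 4 → ℂ, t ≠ 0 ∧ spinorAction t (Φ (b 0)) = 0 ∧
      spinorAction t (Φ (b 1)) = 0 := by
    by_cases h : spinorAction s (Φ (b 1)) = 0
    · exact ⟨s, hs0, hs, h⟩
    · exact ⟨_, h, hanti _ _ _ hs, hsq _ _⟩
  refine ⟨t, ht0, (Submodule.eq_of_le_of_finrank_eq (fun v hv ↦ ?_) ?_).symm⟩
  · have h := congrArg Subtype.val (b.sum_repr ⟨v, hv⟩)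
    simp only [Fin.sum_univ_two, Submodule.coe_add, Submodule.coe_smul] at h
    rw [mem_spinorKernel, ← h]
    simp [ht, ht']
  · rw [hL2, finrank_spinorKernel hB hnd hΦ ht0]

theorem exists_linearEquiv_sum_sq {B : LinearMap.BilinForm ℂ V} (hB : B.IsSymm)
    (hnd : B.Nondegenerate) {n : ℕ} (hn : finrank ℂ V = n) :
    ∃ Φ : V ≃ₗ[ℂ] (Fin n → ℂ), ∀ v, B v v = ∑ i, Φ v i ^ 2 := by
  subst hn
  have hQ : (QuadraticMap.associated (R := ℂ) B.toQuadraticMap).SeparatingLeft := by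
    rw [QuadraticMap.associated_left_inverse ℂ hB.eq]
    exact hnd.1
  obtain ⟨Φ⟩ := QuadraticForm.equivalent_weightedSumSquares_of_isAlgClosed _ hQ
  refine ⟨Φ.toLinearEquiv, fun v ↦ ?_⟩
  have h := Φ.map_app v
  simp only [QuadraticMap.weightedSumSquares_apply, LinearMap.BilinMap.toQuadraticMap_apply] at h
  rw [← h]
  simp [sq]

theorem exists_linearEquiv_splitForm {B : LinearMap.BilinForm ℂ V} (hB : B.IsSymm)
    (hnd : B.Nondegenerate) (hV : finrank ℂ V = 5) {W : Submodule ℂ V} (hW : finrank ℂ W = 3)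
    (hWnd : (B.restrict W).Nondegenerate) :
    ∃ Φ : V ≃ₗ[ℂ] (Fin 5 → ℂ), (∀ v, B v v = splitForm (Φ v)) ∧
      ∀ v, v ∈ W ↔ Φ v 3 = 0 ∧ Φ v 4 = 0 := by
  have hc := B.isCompl_orthogonal_of_restrict_nondegenerate hB.isRefl hWnd
  have hnd' : (B.restrict (B.orthogonal W)).Nondegenerate := by
    refine B.nondegenerate_restrict_of_disjoint_orthogonal hB.isRefl ?_
    rw [LinearMap.BilinForm.orthogonal_orthogonal hnd hB.isRefl]
    exact hc.disjoint.symm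
  have hW' : finrank ℂ (B.orthogonal W) = 2 := by
    rw [LinearMap.BilinForm.finrank_orthogonal hnd, hV, hW]
  obtain ⟨α, hα⟩ := exists_linearEquiv_sum_sq (hB.restrict W) hWnd hW
  obtain ⟨β, hβ⟩ := exists_linearEquiv_sum_sq (hB.restrict _) hnd' hW'
  let P := W.prodEquivOfIsCompl _ hc
  let T : (W × B.orthogonal W) →ₗ[ℂ] (Fin 5 → ℂ) :=
    { toFun := fun p ↦ ![α p.1 1 + Complex.I * α p.1 2, α p.1 0, α p.1 1 - Complex.I * α p.1 2,
        β p.2 0 + Complex.I * β p.2 1, β p.2 0 - Complex.I * β p.2 1]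
      map_add' := fun p p' ↦ by ext i; fin_cases i <;> simp <;> ring
      map_smul' := fun c p ↦ by ext i; fin_cases i <;> simp <;> ring }
  have hT34 (p) : T p 3 = 0 ∧ T p 4 = 0 ↔ p.2 = 0 := by
    rw [← β.map_eq_zero_iff]
    simp only [T, LinearMap.coe_mk, AddHom.coe_mk, Matrix.cons_val, funext_iff,
      Fin.forall_fin_two, Pi.zero_apply]
    have := Complex.I_mul_I
    constructor <;> rintro ⟨h, h'⟩ <;> constructor <;> grind
  have hT : Function.Injective T := by
    rw [← LinearMap.ker_eq_bot, LinearMap.ker_eq_bot']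
    intro p hp
    have h2 := (hT34 p).1 (by simp [hp])
    have h1 : p.1 = 0 := by
      rw [← α.map_eq_zero_iff]
      have e0 := congrFun hp 0
      have e1 := congrFun hp 1
      have e2 := congrFun hp 2
      simp only [T, LinearMap.coe_mk, AddHom.coe_mk, Matrix.cons_val, Pi.zero_apply] at e0 e1 e2
      have := Complex.I_mul_I
      ext i
      fin_cases i <;> simp <;> grind
    exact Prod.ext h1 h2
  let Ψ := T.linearEquivOfInjective hT (by
    rw [P.finrank_eq, hV, finrank_fin_fun])
  refine ⟨P.symm.trans Ψ, fun v ↦ ?_, fun v ↦ ?_⟩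
  · obtain ⟨p, rfl⟩ := P.surjective v
    have h1 := hα p.1
    have h2 := hβ p.2
    have h3 : B (p.1 : V) p.2 = 0 := p.2.2 _ p.1.2
    have h4 : B (p.2 : V) p.1 = 0 := hB.isRefl _ _ h3
    simp only [LinearMap.BilinForm.restrict_apply, LinearMap.domRestrict_apply,
      Fin.sum_univ_succ, Fin.sum_univ_zero] at h1 h2
    have hP : P p = (p.1 : V) + p.2 := by simp [P]
    have hΨ : Ψ p = T p := rfl
    rw [LinearEquiv.trans_apply, LinearEquiv.symm_apply_apply, hΨ, hP]
    simp only [map_add, LinearMap.add_apply, h3, h4]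
    simp [T, splitForm] at h1 h2 ⊢
    rw [h1, h2]
    linear_combination (α p.1 2 ^ 2 + β p.2 1 ^ 2) * Complex.I_sq
  · obtain ⟨p, rfl⟩ := P.surjective v
    have hΨ : Ψ p = T p := rfl
    rw [LinearEquiv.trans_apply, LinearEquiv.symm_apply_apply, hΨ, hT34,
      ← Submodule.prodEquivOfIsCompl_symm_apply_snd_eq_zero _ _ hc, LinearEquiv.symm_apply_apply]
end

/-- Let `Q ⊂ ℙ⁴` be a smooth quadric threefold and `q ⊂ Q` a smooth conic
(cut by a 3-dimensional subspace `W` with nondegenerate restricted form).  Under an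
isomorphism `Hilb^Q_1 ≅ ℙ³` compatible with the hyperplane structure, the locus
`S_q = {[l] : l ∩ q ≠ ∅}` of lines of `Q` meeting `q` is a smooth quadric surface in `ℙ³`,
i.e. the zero locus of a nondegenerate symmetric bilinear form on `ℂ⁴`. -/
theorem stmt12 (V : Type*) [AddCommGroup V] [Module ℂ V] [FiniteDimensional ℂ V]
    (hdim : Module.finrank ℂ V = 5)
    (B : LinearMap.BilinForm ℂ V) (hsymm : B.IsSymm) (hnd : B.Nondegenerate)
    (W : Submodule ℂ V) (hW3 : Module.finrank ℂ W = 3)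
    (hWnd : (B.restrict W).Nondegenerate) :
    ∃ e : {L : Submodule ℂ V // Module.finrank ℂ L = 2 ∧ ∀ v ∈ L, B v v = 0} ≃
          Projectivization ℂ (Fin 4 → ℂ),
      (∀ S : Set {L : Submodule ℂ V // Module.finrank ℂ L = 2 ∧ ∀ v ∈ L, B v v = 0},
        ((∃ H : Submodule ℂ (Fin 4 → ℂ), Module.finrank ℂ H = 3 ∧
            e '' S = {x | Submodule.span ℂ {x.rep} ≤ H}) ↔
         (∃ l0 : {L : Submodule ℂ V // Module.finrank ℂ L = 2 ∧ ∀ v ∈ L, B v v = 0},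
            S = {l | l.1 ⊓ l0.1 ≠ ⊥}))) ∧
      ∃ B' : LinearMap.BilinForm ℂ (Fin 4 → ℂ), B'.IsSymm ∧ B'.Nondegenerate ∧
        ∀ l : {L : Submodule ℂ V // Module.finrank ℂ L = 2 ∧ ∀ v ∈ L, B v v = 0},
          (l.1 ⊓ W ≠ ⊥ ↔ B' (e l).rep (e l).rep = 0) := by
  obtain ⟨Φ, hΦ, hΦW⟩ := exists_linearEquiv_splitForm hsymm hnd hdim hW3 hWnd
  let f (x : Projectivization ℂ (Fin 4 → ℂ)) :
      {L : Submodule ℂ V // Module.finrank ℂ L = 2 ∧ ∀ v ∈ L, B v v = 0} :=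
    ⟨spinorKernel Φ x.rep, finrank_spinorKernel hsymm hnd hΦ x.rep_nonzero,
      fun _ ↦ isotropic_of_mem_spinorKernel hΦ x.rep_nonzero⟩
  have f_mk {s : Fin 4 → ℂ} (hs : s ≠ 0) :
      (f (Projectivization.mk ℂ s hs)).1 = spinorKernel Φ s := by
    obtain ⟨a, ha⟩ := Projectivization.exists_smul_eq_mk_rep ℂ s hs
    exact (congrArg (spinorKernel Φ) ha.symm).trans (spinorKernel_smul Φ a.ne_zero s)
  have f_bijective : Function.Bijective f := by
    constructor
    · intro x y hxy
      obtain ⟨c, hc⟩ := exists_smul_eq_of_spinorKernel_eq hsymm hnd hΦ x.rep_nonzero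
        (congrArg Subtype.val hxy)
      rw [← x.mk_rep, ← y.mk_rep, eq_comm, Projectivization.mk_eq_mk_iff']
      exact ⟨c, hc.symm⟩
    · rintro ⟨L, hL2, hL⟩
      obtain ⟨s, hs, rfl⟩ := exists_eq_spinorKernel hsymm hnd hΦ hL2 hL
      exact ⟨Projectivization.mk ℂ s hs, Subtype.ext (f_mk hs)⟩
  let e := (Equiv.ofBijective f f_bijective).symm
  have he (l) : l.1 = spinorKernel Φ (e l).rep :=
    congrArg Subtype.val ((Equiv.ofBijective f f_bijective).apply_symm_apply l).symm
  have hmeet {s : Fin 4 → ℂ} (hs : s ≠ 0) (l) :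
      l.1 ⊓ spinorKernel Φ s ≠ ⊥ ↔ (e l).rep ∈ LinearMap.ker (spinorSymplectic s) := by
    rw [he l, inf_comm, spinorKernel_inf_ne_bot_iff hsymm hnd hΦ hs (e l).rep_nonzero,
      LinearMap.mem_ker]
  have himage (S : Set _) (T : Set (Projectivization ℂ (Fin 4 → ℂ))) :
      e '' S = T ↔ S = e ⁻¹' T := by
    rw [e.image_eq_preimage_symm, e.symm.preimage_eq_iff_eq_image, e.symm.image_eq_preimage_symm,
      e.symm_symm]
  refine ⟨e, fun S ↦ ?_, spinorQuadric, spinorQuadric_isSymm, spinorQuadric_nondegenerate,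
    fun l ↦ ?_⟩
  · simp only [himage, Set.preimage_ofPred_eq, Submodule.span_singleton_le_iff_mem]
    constructor
    · rintro ⟨H, hH, rfl⟩
      obtain ⟨s, hs, rfl⟩ := exists_ker_spinorSymplectic_eq hH
      refine ⟨f (Projectivization.mk ℂ s hs), Set.ext fun l ↦ ?_⟩
      rw [Set.mem_ofPred_eq, Set.mem_ofPred_eq, f_mk, hmeet hs]
    · rintro ⟨l0, rfl⟩
      refine ⟨_, finrank_ker_spinorSymplectic (e l0).rep_nonzero, Set.ext fun l ↦ ?_⟩
      rw [Set.mem_ofPred_eq, Set.mem_ofPred_eq, he l0, hmeet (e l0).rep_nonzero]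
  · rw [← exists_spinorAction_eq_zero_iff (e l).rep_nonzero, Submodule.ne_bot_iff,
      Φ.surjective.exists, he l]
    simp only [Submodule.mem_inf, mem_spinorKernel, hΦW, ne_eq, Φ.map_eq_zero_iff]
    exact exists_congr fun v ↦ by tauto
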